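/- Let F = ℂ(t₁, t₂) be the fraction field of the polynomial ring ℂ[t₁, t₂] in two variables (the fraction field of MvPolynomial (Fin 2) ℂ), and set ξ = t₁t₂ ∈ F. Let n be a positive integer and d a positive divisor of n, and assume that the polynomial X^n − ξ is irreducible over F; let L = F[X]/(X^n − ξ), a field extension of F of degree n. Let f ∈ ℂ[t₁, t₂] be a polynomial such that (f(0, t₂))^{n/d}, the (n/d)-th power of the one-variable polynomial obtained by substituting t₁ = 0 in f, is not an n-th power in the rational function field ℂ(t₂). Then the element f^{n/d} ∈ F is not the norm of any element of L; that is, there is no u ∈ L with Norm_{L/F}(u) = f^{n/d}. -/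

import Mathlib

open Polynomial

lemma aux_det {B ι : Type*} [CommRing B] [IsDomain B] [Fintype ι] [DecidableEq ι]
    (M : Matrix ι ι B) (n : ℕ) (hM : M ^ n = 0) (P : B[X]) :
    (aeval M P).det = P.coeff 0 ^ Fintype.card ι := by
  have hP : P = C (P.coeff 0) - X * (-P.divX) := by
    conv_lhs => rw [← X_mul_divX_add P]
    ring
  set N : Matrix ι ι B := aeval M (X * (-P.divX)) with hN
  have hnil : IsNilpotent N := by
    refine ⟨n, ?_⟩
    rw [hN, ← map_pow, mul_pow, map_mul, map_pow, aeval_X, hM, zero_mul]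
  have h1 := Matrix.isNilpotent_charpoly_sub_pow_of_isNilpotent hnil
  have h2 := sub_eq_zero.1 h1.eq_zero
  have h3 := Matrix.eval_charpoly N (P.coeff 0)
  rw [h2] at h3
  simp only [eval_pow, eval_X] at h3
  rw [h3]
  congr 1
  conv_lhs => rw [hP]
  rw [map_sub, aeval_C, ← hN]
  rfl

lemma aux_map {A B ι : Type*} [CommRing A] [CommRing B] [Fintype ι] [DecidableEq ι]
    (φ : A →+* B) (M : Matrix ι ι A) (P : A[X]) :
    φ (aeval M P).det = (aeval (φ.mapMatrix M) (P.map φ)).det := by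
  rw [RingHom.map_det]
  congr 1
  induction P using Polynomial.induction_on' with
  | add p q hp hq => simp only [map_add, Polynomial.map_add, hp, hq]
  | monomial k a =>
    rw [aeval_monomial, Polynomial.map_monomial, aeval_monomial, map_mul, map_pow]
    congr 1
    ext i j
    simp [Matrix.algebraMap_matrix_apply, apply_ite φ]

lemma aux_key {A B ι : Type*} [CommRing A] [IsDomain A] [CommRing B] [IsDomain B]
    [Fintype ι] [DecidableEq ι] (φ : A →+* B) (s t e : A) (hs : φ s = 0) (hs0 : s ≠ 0)
    (ht0 : t ≠ 0) (hker : ∀ a, φ a = 0 → s ∣ a) (m : ℕ) (hcard : Fintype.card ι = m + 1)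
    (M : Matrix ι ι A) (hM : M ^ (m + 1) = algebraMap A _ (s * t))
    (hdet : M.det = e * (s * t)) (he : e * e = 1) (k : ℕ) :
    ∀ (P : A[X]) (h : A), (aeval M P).det = s ^ k * h →
      ∃ g : B, φ h * (φ (e * t ^ m)) ^ k = g ^ (m + 1) := by
  have hspec : ∀ P : A[X], φ (aeval M P).det = φ (P.coeff 0) ^ (m + 1) := by
    intro P
    rw [aux_map, aux_det _ (m + 1), hcard, coeff_map]
    rw [← map_pow, hM]
    ext i j
    rw [RingHom.mapMatrix_apply, Matrix.map_apply, Matrix.algebraMap_matrix_apply]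
    split_ifs <;> simp [hs]
  induction k with
  | zero =>
    intro P h hP
    refine ⟨φ (P.coeff 0), ?_⟩
    rw [← hspec, hP]; simp
  | succ k ih =>
    intro P h hP
    have h0 : φ (P.coeff 0) = 0 := by
      have := hspec P
      rw [hP] at this
      simp only [map_mul, map_pow, hs] at this
      rw [pow_succ, mul_zero, zero_mul] at this
      exact pow_eq_zero_iff (Nat.succ_ne_zero m) |>.1 this.symm
    obtain ⟨c, hc⟩ := hker _ h0
    set P' : A[X] := C c * X ^ m + C t * P.divX with hP'
    have hmul : aeval M (C t * P) = aeval M (X * P') := by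
      have : C t * P = X * P' + C c * (C (s * t) - X ^ (m + 1)) := by
        conv_lhs => rw [← X_mul_divX_add P, hc]
        rw [hP']
        simp only [C_mul]
        ring
      rw [this, map_add, map_mul (aeval M) (C c), map_sub, aeval_C, aeval_C, map_pow, aeval_X, hM, sub_self,
        mul_zero, add_zero]
    have hd := congrArg Matrix.det hmul
    rw [map_mul, map_mul, Matrix.det_mul, Matrix.det_mul, aeval_X, hdet, aeval_C, hP,
      Matrix.algebraMap_eq_diagonal, Matrix.det_diagonal] at hd
    simp only [Pi.algebraMap_apply, Algebra.algebraMap_self, RingHom.id_apply, Finset.prod_const,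
      Finset.card_univ, hcard] at hd
    have hd2 : (aeval M P').det = s ^ k * (e * t ^ m * h) := by
      apply mul_left_cancel₀ (mul_ne_zero hs0 ht0)
      linear_combination (-e) * hd - (s * t) * (aeval M P').det * he
    obtain ⟨g, hg⟩ := ih P' _ hd2
    refine ⟨g, ?_⟩
    rw [← hg, map_mul φ _ h]
    ring

lemma aux_ker (a : MvPolynomial (Fin 2) ℂ)
    (ha : MvPolynomial.aeval ![(0 : ℂ[X]), Polynomial.X] a = 0) :
    (MvPolynomial.X 0 : MvPolynomial (Fin 2) ℂ) ∣ a := by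
  let ψ : ℂ[X] →ₐ[ℂ] MvPolynomial (Fin 2) ℂ := aeval (MvPolynomial.X 1)
  let I : Ideal (MvPolynomial (Fin 2) ℂ) := Ideal.span {MvPolynomial.X 0}
  have : ((Ideal.Quotient.mkₐ ℂ I).comp ψ).comp
      (MvPolynomial.aeval ![(0 : ℂ[X]), Polynomial.X]) = Ideal.Quotient.mkₐ ℂ I := by
    apply MvPolynomial.algHom_ext
    intro i
    fin_cases i
    · simp
      symm
      rw [Ideal.Quotient.eq_zero_iff_mem]
      exact Ideal.mem_span_singleton_self _
    · simp [ψ]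
  have h2 := DFunLike.congr_fun this a
  simp only [AlgHom.comp_apply, ha, map_zero] at h2
  have h3 := Ideal.Quotient.eq_zero_iff_mem.1 h2.symm
  exact Ideal.mem_span_singleton.1 h3

/-- Everything but the specialisation, for a general domain with fraction field. -/
lemma aux_matrix {A F : Type*} [CommRing A] [IsDomain A] [Field F] [Algebra A F]
    [IsFractionRing A F] (n : ℕ) (hn : 0 < n) (x : A)
    (hne : (X ^ n - C (algebraMap A F x)) ≠ 0)
    (u : AdjoinRoot (X ^ n - C (algebraMap A F x))) :
    ∃ (M : Matrix (Fin (AdjoinRoot.powerBasis hne).dim) (Fin (AdjoinRoot.powerBasis hne).dim) A)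
      (P : A[X]) (b : A), b ≠ 0 ∧ M ^ n = algebraMap A _ x ∧ M.det = (-1) ^ (n + 1) * x ∧
      algebraMap A F (aeval M P).det = algebraMap A F b ^ n * Algebra.norm F u := by
  have hmon : (X ^ n - C (algebraMap A F x)).Monic := monic_X_pow_sub_C _ hn.ne'
  set pb := AdjoinRoot.powerBasis hne with hpb
  have hdim : pb.dim = n := by
    rw [hpb, AdjoinRoot.powerBasis_dim, natDegree_X_pow_sub_C]
  have hmin : minpoly F pb.gen = X ^ n - C (algebraMap A F x) :=
    AdjoinRoot.minpoly_powerBasis_gen_of_monic hmon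
  have hinj := IsFractionRing.injective A F
  obtain ⟨M, hM⟩ : ∃ M : Matrix (Fin pb.dim) (Fin pb.dim) A,
      (algebraMap A F).mapMatrix M = Algebra.leftMulMatrix pb.basis pb.gen := by
    refine ⟨Matrix.of fun i j => if (j : ℕ) + 1 = pb.dim then
      -(X ^ n - C x : A[X]).coeff i else if (i : ℕ) = j + 1 then 1 else 0, ?_⟩
    rw [pb.leftMulMatrix, pb.minpolyGen_eq, hmin]
    have : (X ^ n - C (algebraMap A F x)) = (X ^ n - C x : A[X]).map (algebraMap A F) := by simp
    ext i j
    have hi := congrArg (fun q => q.coeff (i : ℕ)) this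
    simp only [coeff_map] at hi
    simp only [RingHom.mapMatrix_apply, Matrix.map_apply, Matrix.of_apply, hi]
    split_ifs <;> simp
  have hgen : pb.gen ^ n = algebraMap F _ (algebraMap A F x) := by
    have := minpoly.aeval F pb.gen
    rw [hmin] at this
    simpa [sub_eq_zero] using this
  obtain ⟨p, rfl⟩ := AdjoinRoot.mk_surjective u
  obtain ⟨b, hb, hP⟩ := IsLocalization.integerNormalization_spec (nonZeroDivisors A) p
  refine ⟨M, IsLocalization.integerNormalization (nonZeroDivisors A) p, b,
    nonZeroDivisors.ne_zero hb, ?_, ?_, ?_⟩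
  · have : Function.Injective ((algebraMap A F).mapMatrix (m := Fin pb.dim)) :=
      Matrix.map_injective hinj
    apply this
    rw [map_pow, hM, ← map_pow, hgen, AlgHom.commutes]
    ext i j
    simp [Matrix.algebraMap_matrix_apply, apply_ite (algebraMap A F)]
  · apply hinj
    rw [RingHom.map_det, hM, ← Algebra.norm_eq_matrix_det,
      Algebra.PowerBasis.norm_gen_eq_coeff_zero_minpoly, hmin, hdim]
    simp [hn.ne', hn.ne, pow_succ]
  · rw [aux_map, hM, hP, Polynomial.aeval_algHom_apply, ← Algebra.norm_eq_matrix_det]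
    have : aeval pb.gen (b • p) =
        algebraMap F _ (algebraMap A F b) * AdjoinRoot.mk (X ^ n - C (algebraMap A F x)) p := by
      rw [← IsScalarTower.algebraMap_smul F b p, map_smul, Algebra.smul_def, hpb,
        AdjoinRoot.powerBasis_gen, AdjoinRoot.aeval_eq]
    rw [this, map_mul, Algebra.norm_algebraMap_of_basis pb.basis, Fintype.card_fin, hdim]


/-- **The non-norm computation of paragraph 3.10.3:** with `F = ℂ(t₁,t₂)`, `ξ = t₁t₂` and
`L = F(ξ^{1/n})`, if `(f(0,t₂))^{n/d}` is not an `n`-th power in `ℂ(t₂)` then `f^{n/d}` is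
not a norm from `L`. -/
theorem pow_not_norm_of_not_pow
    (n d : ℕ) (hn : 0 < n) (hd : 0 < d) (hdvd : d ∣ n)
    (hirr : Irreducible
      (X ^ n - C (algebraMap (MvPolynomial (Fin 2) ℂ) (FractionRing (MvPolynomial (Fin 2) ℂ))
        (MvPolynomial.X 0 * MvPolynomial.X 1))))
    (f : MvPolynomial (Fin 2) ℂ)
    (hf : ¬ ∃ g : RatFunc ℂ, g ^ n =
      algebraMap (Polynomial ℂ) (RatFunc ℂ)
        ((MvPolynomial.aeval ![0, Polynomial.X] f) ^ (n / d)))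
    (u : AdjoinRoot
      (X ^ n - C (algebraMap (MvPolynomial (Fin 2) ℂ) (FractionRing (MvPolynomial (Fin 2) ℂ))
        (MvPolynomial.X 0 * MvPolynomial.X 1)))) :
    Algebra.norm (FractionRing (MvPolynomial (Fin 2) ℂ)) u ≠
      algebraMap (MvPolynomial (Fin 2) ℂ) (FractionRing (MvPolynomial (Fin 2) ℂ)) f ^ (n / d) := by
  intro hu
  obtain ⟨M, P, b, hb, hM, hdet, hN⟩ := aux_matrix n hn _ hirr.ne_zero u
  obtain ⟨m, rfl⟩ : ∃ m, n = m + 1 := ⟨n - 1, by omega⟩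
  have hX : ∀ i, (MvPolynomial.X i : MvPolynomial (Fin 2) ℂ) ≠ 0 := fun i =>
    MvPolynomial.X_ne_zero i
  let φ : MvPolynomial (Fin 2) ℂ →ₐ[ℂ] ℂ[X] := MvPolynomial.aeval ![0, Polynomial.X]
  have hφ0 : φ (MvPolynomial.X 0) = 0 := by simp [φ]
  have hnu : ¬ IsUnit (MvPolynomial.X 0 : MvPolynomial (Fin 2) ℂ) := by
    intro h
    have := h.map φ
    rw [hφ0] at this
    exact not_isUnit_zero this
  obtain ⟨j, c, hc, rfl⟩ := WfDvdMonoid.max_power_factor' hb hnu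
  have hφc : φ c ≠ 0 := fun h => hc (aux_ker c h)
  have hφ1 : φ (MvPolynomial.X 1) = X := by simp [φ]
  have hN2 : (aeval M P).det = MvPolynomial.X 0 ^ (j * (m + 1)) *
      (c ^ (m + 1) * f ^ ((m + 1) / d)) := by
    apply IsFractionRing.injective (MvPolynomial (Fin 2) ℂ)
      (FractionRing (MvPolynomial (Fin 2) ℂ))
    rw [hN, hu]
    simp only [map_mul, map_pow]
    ring
  obtain ⟨g, hg⟩ := aux_key φ.toRingHom (MvPolynomial.X 0) (MvPolynomial.X 1) ((-1) ^ (m + 1 + 1))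
    hφ0 (hX 0) (hX 1) aux_ker m
    (by rw [Fintype.card_fin, AdjoinRoot.powerBasis_dim, natDegree_X_pow_sub_C])
    M hM hdet (by rw [← mul_pow]; simp) _ P _ hN2
  apply hf
  have hg' : (φ c) ^ (m + 1) * φ f ^ ((m + 1) / d) *
      ((-1) ^ (m + 1 + 1) * X ^ m) ^ (j * (m + 1)) = g ^ (m + 1) := by
    rw [← hg]
    simp [hφ1]
  set q : ℂ[X] := φ c * ((-1) ^ (m + 1 + 1) * X ^ m) ^ j with hq
  have hq0 : q ≠ 0 := mul_ne_zero hφc (pow_ne_zero _ (mul_ne_zero (pow_ne_zero _ (by simp))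
    (pow_ne_zero _ X_ne_zero)))
  have hqg : φ f ^ ((m + 1) / d) * q ^ (m + 1) = g ^ (m + 1) := by
    rw [← hg', hq, mul_pow, ← pow_mul]; ring
  have hq1 : algebraMap ℂ[X] (RatFunc ℂ) q ≠ 0 := by
    simpa using hq0
  refine ⟨algebraMap ℂ[X] (RatFunc ℂ) g / algebraMap ℂ[X] (RatFunc ℂ) q, ?_⟩
  rw [div_pow, div_eq_iff (pow_ne_zero _ hq1), ← map_pow (algebraMap ℂ[X] (RatFunc ℂ)) g,
    ← map_pow (algebraMap ℂ[X] (RatFunc ℂ)) q, ← map_mul, ← hqg]
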